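/- Let G be a vertex-minimal triangle-free, fork-free graph with chromatic number at least 4. Let C be a 5-cycle in G, let u1, u2 be nonadjacent vertices at distance exactly 2 from C, and let v be a vertex of C. If u1 a1 v and u2 b1 v are two independent paths of length 2 in G (i.e., a1 ≠ b1, and a1, b1 are not on C), then a1 is adjacent to u2 and b1 is adjacent to u1. -/

import Mathlib

open SimpleGraph

/-- The fork: `K_{1,4}` with two edges subdivided. Vertex 0 is the center,
adjacent to leaves 1, 2 and to 3, 5; paths 0-3-4 and 0-5-6. -/
def fork : SimpleGraph (Fin 7) :=
  SimpleGraph.fromEdgeSet {s(0, 1), s(0, 2), s(0, 3), s(0, 5), s(3, 4), s(5, 6)}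

/-- A graph is fork-free if it has no induced subgraph isomorphic to the fork. -/
def ForkFree {V : Type} (G : SimpleGraph V) : Prop :=
  IsEmpty (fork ↪g G)

/-- `G` is a vertex-minimal triangle-free, fork-free graph with chromatic
number at least 4: every smaller triangle-free fork-free graph is 3-colorable. -/
def MinCex {V : Type} [Fintype V] (G : SimpleGraph V) : Prop :=
  G.CliqueFree 3 ∧ ForkFree G ∧ 4 ≤ G.chromaticNumber ∧
    ∀ (W : Type) [Fintype W] (H : SimpleGraph W),
      Fintype.card W < Fintype.card V → H.CliqueFree 3 → ForkFree H →
        H.chromaticNumber ≤ 3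

/-- `c` describes a 5-cycle in `G`. -/
def IsC5 {V : Type} (G : SimpleGraph V) (c : Fin 5 → V) : Prop :=
  Function.Injective c ∧ ∀ i : Fin 5, G.Adj (c i) (c (i + 1))

/-- Distance from a vertex `u` to the 5-cycle `c`. -/
noncomputable def distC {V : Type} (G : SimpleGraph V) (c : Fin 5 → V) (u : V) : ℕ :=
  Finset.univ.inf' Finset.univ_nonempty fun i => G.dist u (c i)

theorem tri_free {V : Type} {G : SimpleGraph V} (h : G.CliqueFree 3) {x y z : V}
    (hxy : G.Adj x y) (hyz : G.Adj y z) : ¬ G.Adj x z := by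
  classical
  intro hxz
  exact h {x, y, z} (is3Clique_triple_iff.2 ⟨hxy, hxz, hyz⟩)

/-- The seven nonadjacencies that are not automatic in a triangle-free graph. -/
theorem no_fork {V : Type} {G : SimpleGraph V} (hT : G.CliqueFree 3) (hF : ForkFree G)
    {c l m p q r s : V} (hlm : l ≠ m) (cl : G.Adj c l) (cm : G.Adj c m)
    (cp : G.Adj c p) (pq : G.Adj p q) (cr : G.Adj c r) (rs : G.Adj r s)
    (lq : ¬ G.Adj l q) (ls : ¬ G.Adj l s) (mq : ¬ G.Adj m q) (ms : ¬ G.Adj m s)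
    (ps : ¬ G.Adj p s) (rq : ¬ G.Adj r q) (qs : ¬ G.Adj q s) : False := by
  have tri : ∀ {x y z : V}, G.Adj x y → G.Adj y z → ¬ G.Adj x z := fun h h' => tri_free hT h h'
  have h1 := tri cl.symm cm
  have h2 := tri cl.symm cp
  have h3 := tri cl.symm cr
  have h4 := tri cm.symm cp
  have h5 := tri cm.symm cr
  have h6 := tri cp.symm cr
  have h7 := tri cp pq
  have h8 := tri cr rs
  have ne1 : ∀ {w x y : V}, G.Adj w x → ¬ G.Adj w y → x ≠ y := fun h h' e => h' (e ▸ h)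
  have d1 := cl.ne
  have d2 := cm.ne
  have d3 := cp.ne
  have d4 := cr.ne
  have d5 := pq.ne
  have d6 := rs.ne
  have d7 : c ≠ q := fun e => lq (e ▸ cl.symm)
  have d8 : c ≠ s := fun e => ls (e ▸ cl.symm)
  have d9 : l ≠ p := fun e => lq (e ▸ pq)
  have d10 : l ≠ r := fun e => ls (e ▸ rs)
  have d11 : m ≠ p := fun e => mq (e ▸ pq)
  have d12 : m ≠ r := fun e => ms (e ▸ rs)
  have d13 : p ≠ r := fun e => ps (e ▸ rs)
  have d14 := ne1 cl h7
  have d15 := ne1 cl h8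
  have d16 := ne1 cm h7
  have d17 := ne1 cm h8
  have d18 := ne1 cp h8
  have d19 := ne1 cr h7
  have d20 := ne1 pq ps
  let f : Fin 7 → V := ![c, l, m, p, q, r, s]
  have hinj : Function.Injective f := by
    intro i j hij
    fin_cases i <;> fin_cases j <;> simp [f] at hij ⊢ <;> first | exact absurd hij ‹_› | exact absurd hij.symm ‹_›
  refine hF.false ⟨⟨f, hinj⟩, ?_⟩
  intro i j
  fin_cases i <;> fin_cases j <;> simp [f, fork] <;> first | assumption | (rw [G.adj_comm]; assumption)

theorem induce_col {V : Type} [Fintype V] {G : SimpleGraph V} (hG : MinCex G) (S : Set V)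
    (x : V) (hx : x ∉ S) : (G.induce S).Colorable 3 := by
  classical
  have h := hG.2.2.2 S (G.induce S) (Fintype.card_subtype_lt hx)
    (hG.1.comap ⟨(Embedding.induce S).toCopy⟩)
    ⟨fun f => hG.2.1.false ((Embedding.induce S).comp f)⟩
  exact chromaticNumber_le_iff_colorable.1 h

theorem not_col {V : Type} [Fintype V] {G : SimpleGraph V} (hG : MinCex G) :
    ¬ G.Colorable 3 := by
  intro h
  have h1 := hG.2.2.1.trans (chromaticNumber_le_iff_colorable.2 h)
  exact absurd h1 (by decide)

/-- No vertex is dominated by a nonadjacent vertex. -/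
theorem not_dom {V : Type} [Fintype V] {G : SimpleGraph V} (hG : MinCex G) (x y : V)
    (hne : x ≠ y) (hn : ¬ G.Adj x y) : ∃ z, G.Adj x z ∧ ¬ G.Adj y z := by
  classical
  by_contra! hcon
  obtain ⟨f⟩ := induce_col hG {z | z ≠ x} x (by simp)
  apply not_col hG
  have hf : ∀ a b (ha : a ≠ x) (hb : b ≠ x), G.Adj a b → f ⟨a, ha⟩ ≠ f ⟨b, hb⟩ :=
    fun a b ha hb h => f.valid (by simpa using h)
  refine ⟨Coloring.mk (fun z => if h : z = x then f ⟨y, hne.symm⟩ else f ⟨z, h⟩) ?_⟩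
  intro a b hab
  by_cases ha : a = x <;> by_cases hb : b = x
  · subst ha; subst hb; exact absurd hab (G.irrefl)
  · subst ha
    simpa [hb] using hf y b hne.symm hb (hcon b hab)
  · subst hb
    simpa [ha] using hf a y ha hne.symm (hcon a hab.symm).symm
  · simpa [ha, hb] using hf a b ha hb hab

theorem col_valid {V : Type} {G : SimpleGraph V} [DecidableEq V] [DecidableRel G.Adj]
    {v2 v3 v4 v5 v6 v10 a b : V} (n24 : ¬ G.Adj v2 v4) (n35 : ¬ G.Adj v3 v5)
    (n56 : ¬ G.Adj v5 v6) (n_3_10 : ¬ G.Adj v3 v10) (n_5_10 : ¬ G.Adj v5 v10)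
    (ka : G.Adj v5 a → ¬ G.Adj v10 a) (kb : G.Adj v5 b → ¬ G.Adj v10 b)
    (la : G.Adj v3 a → a = v2 ∨ a = v4 ∨ a = v6) (lb : G.Adj v3 b → b = v2 ∨ b = v4 ∨ b = v6)
    (ma : a = v2 ∨ a = v3 ∨ a = v4 ∨ G.Adj v5 a ∨ a = v10 ∨ G.Adj v10 a ∨ a = v5)
    (mb : b = v2 ∨ b = v3 ∨ b = v4 ∨ G.Adj v5 b ∨ b = v10 ∨ G.Adj v10 b ∨ b = v5)
    (t5 : G.Adj v5 a → ¬ G.Adj v5 b) (t10 : G.Adj v10 a → ¬ G.Adj v10 b) (hab : G.Adj a b) :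
    (if a = v2 ∨ a = v4 then (2 : Fin 3) else if G.Adj v5 a ∨ a = v10 ∨ a = v3 then 0 else 1) ≠
      (if b = v2 ∨ b = v4 then (2 : Fin 3) else
        if G.Adj v5 b ∨ b = v10 ∨ b = v3 then 0 else 1) := by
  have hba := hab.symm
  have iab := hab.ne
  have n42 : ¬ G.Adj v4 v2 := fun h => n24 h.symm
  have s1 : G.Adj v10 a → G.Adj a v10 := fun h => h.symm
  have s2 : G.Adj v10 b → G.Adj b v10 := fun h => h.symm
  have s3 : G.Adj v5 a → G.Adj a v5 := fun h => h.symm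
  have s4 : G.Adj v5 b → G.Adj b v5 := fun h => h.symm
  split_ifs <;> first | decide | skip
  all_goals exfalso
  all_goals grind

theorem core {V : Type} [Fintype V] {G : SimpleGraph V} (hG : MinCex G)
    {v0 v1 v2 v3 v4 v5 v6 v7 v8 : V}
    (e_0_1 : G.Adj v0 v1) (e_1_2 : G.Adj v1 v2) (e_2_3 : G.Adj v2 v3) (e_3_4 : G.Adj v3 v4) (e_0_4 : G.Adj v0 v4)
    (e_0_5 : G.Adj v0 v5) (e_0_6 : G.Adj v0 v6) (e_5_7 : G.Adj v5 v7) (e_5_8 : G.Adj v5 v8) (e_6_8 : G.Adj v6 v8)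
    (n_7_8 : ¬ G.Adj v7 v8) (n_6_7 : ¬ G.Adj v6 v7) (n_1_7 : ¬ G.Adj v1 v7) (n_2_7 : ¬ G.Adj v2 v7) (n_3_7 : ¬ G.Adj v3 v7) (n_4_7 : ¬ G.Adj v4 v7)
    (n_1_8 : ¬ G.Adj v1 v8) (n_2_8 : ¬ G.Adj v2 v8) (n_3_8 : ¬ G.Adj v3 v8) (n_4_8 : ¬ G.Adj v4 v8)
    (e_2_5 : G.Adj v2 v5) (e_3_6 : G.Adj v3 v6) : False := by
  classical
  have tri : ∀ {x y z : V}, G.Adj x y → G.Adj y z → ¬ G.Adj x z := fun h h' => tri_free hG.1 h h'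
  have nf := @no_fork V G hG.1 hG.2.1
  have sy : ∀ {x y : V}, ¬ G.Adj x y → ¬ G.Adj y x := fun h h' => h h'.symm
  have ne1 : ∀ {w x y : V}, G.Adj w x → ¬ G.Adj w y → x ≠ y := fun h h' e => h' (e ▸ h)
  have dom := not_dom hG
  obtain ⟨v9, e_7_9, n_8_9⟩ := dom v7 v8 (ne1 e_6_8 n_6_7).symm n_7_8
  have n_0_9 : ¬ G.Adj v0 v9 := by
    intro e_0_9
    exact nf (ne1 e_1_2.symm (tri e_2_3 e_3_4)) e_0_1 e_0_4 e_0_6 e_6_8 e_0_9 e_7_9.symm n_1_8 n_1_7 n_4_8 n_4_7 n_6_7 (sy n_8_9) (sy n_7_8)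
  have n_3_9 : ¬ G.Adj v3 v9 := by
    intro e_3_9
    exact nf (ne1 e_0_4 (tri e_0_1 e_1_2)).symm e_2_3.symm e_3_4 e_3_6 e_6_8 e_3_9 e_7_9.symm n_2_8 n_2_7 n_4_8 n_4_7 n_6_7 (sy n_8_9) (sy n_7_8)
  have n_1_9 : ¬ G.Adj v1 v9 := by
    intro e_1_9
    exact nf (ne1 e_0_1.symm n_1_8) e_0_5.symm e_5_8 e_2_5.symm e_2_3 e_5_7 e_7_9 (tri e_0_4 e_3_4.symm) n_0_9 (sy n_3_8) n_8_9 (tri e_1_2.symm e_1_9) (sy n_3_7) n_3_9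
  have e_2_9 : G.Adj v2 v9 := by
    by_contra n_2_9
    exact nf (ne1 e_0_1.symm n_1_8) e_0_5.symm e_5_8 e_2_5.symm e_2_3 e_5_7 e_7_9 (tri e_0_4 e_3_4.symm) n_0_9 (sy n_3_8) n_8_9 n_2_9 (sy n_3_7) n_3_9
  have e_4_9 : G.Adj v4 v9 := by
    by_contra n_4_9
    exact nf (ne1 e_0_1 n_0_9) e_1_2.symm e_2_9 e_2_3 e_3_4 e_2_5 e_5_8 (tri e_0_1.symm e_0_4) n_1_8 (sy n_4_9) (sy n_8_9) n_3_8 (tri e_0_5.symm e_0_4) n_4_8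
  have n_6_9 : ¬ G.Adj v6 v9 := by
    intro e_6_9
    exact nf (ne1 e_2_3 n_2_8) e_3_6.symm e_6_8 e_0_6.symm e_0_1 e_6_9 e_7_9.symm (tri e_2_3.symm e_1_2.symm) n_3_7 (sy n_1_8) (sy n_7_8) (tri e_0_5 e_5_7) (sy n_1_9) n_1_7
  obtain ⟨v10, e_1_10, n_5_10⟩ := dom v1 v5 (ne1 e_5_7.symm (sy n_1_7)).symm (tri e_0_1.symm e_0_5)
  have n_3_10 : ¬ G.Adj v3 v10 := by
    intro e_3_10
    have n_7_10 : ¬ G.Adj v7 v10 := by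
      intro e_7_10
      exact nf (ne1 e_2_5 (tri e_2_3 e_3_6)) e_0_5 e_0_6 e_0_1 e_1_10 e_0_4 e_4_9 n_5_10 (tri e_2_5.symm e_2_9) (tri e_3_6.symm e_3_10) n_6_9 n_1_9 (tri e_3_4.symm e_3_10) (tri e_7_10.symm e_7_9)
    exact nf (ne1 e_6_8.symm (sy n_4_8)).symm e_0_4 e_0_6 e_0_1 e_1_10 e_0_5 e_5_7 (tri e_3_4.symm e_3_10) n_4_7 (tri e_3_6.symm e_3_10) n_6_7 n_1_7 n_5_10 (sy n_7_10)
  have n_4_10 : ¬ G.Adj v4 v10 := by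
    intro e_4_10
    have n_6_10 : ¬ G.Adj v6 v10 := by
      intro e_6_10
      exact nf (ne1 e_3_6.symm n_6_9) e_2_3 e_2_9 e_1_2.symm e_1_10 e_2_5 e_5_8 n_3_10 n_3_8 (tri e_4_9.symm e_4_10) (sy n_8_9) n_1_8 n_5_10 (tri e_6_10.symm e_6_8)
    exact nf (ne1 e_0_5 n_0_9) e_2_5 e_2_9 e_1_2.symm e_1_10 e_2_3 e_3_6 n_5_10 (tri e_0_5.symm e_0_6) (tri e_4_9.symm e_4_10) (sy n_6_9) (tri e_0_1.symm e_0_6) n_3_10 (sy n_6_10)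
  have e_6_10 : G.Adj v6 v10 := by
    by_contra n_6_10
    have n_7_10 : ¬ G.Adj v7 v10 := by
      intro e_7_10
      exact nf (ne1 e_2_5 (tri e_2_3 e_3_6)) e_0_5 e_0_6 e_0_1 e_1_10 e_0_4 e_4_9 n_5_10 (tri e_2_5.symm e_2_9) n_6_10 n_6_9 n_1_9 n_4_10 (tri e_7_10.symm e_7_9)
    exact nf (ne1 e_6_8.symm (sy n_4_8)).symm e_0_4 e_0_6 e_0_1 e_1_10 e_0_5 e_5_7 n_4_10 n_4_7 n_6_10 n_6_7 n_1_7 n_5_10 (sy n_7_10)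
  have n_7_10 : ¬ G.Adj v7 v10 := by
    intro e_7_10
    exact nf (ne1 e_3_6.symm n_6_9) e_2_3 e_2_9 e_1_2.symm e_1_10 e_2_5 e_5_8 n_3_10 n_3_8 (tri e_7_9.symm e_7_10) (sy n_8_9) n_1_8 n_5_10 (tri e_6_10.symm e_6_8)
  have e_9_10 : G.Adj v9 v10 := by
    by_contra n_9_10
    exact nf (ne1 e_3_6.symm n_6_9) e_2_3 e_2_9 e_1_2.symm e_1_10 e_2_5 e_5_8 n_3_10 n_3_8 n_9_10 (sy n_8_9) n_1_8 n_5_10 (tri e_6_10.symm e_6_8)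
  obtain ⟨v11, e_7_11, n_2_11⟩ := dom v7 v2 (ne1 e_1_2 n_1_7).symm (sy n_2_7)
  have n_0_11 : ¬ G.Adj v0 v11 := by
    intro e_0_11
    exact nf (ne1 e_6_8.symm (sy n_4_8)).symm e_0_4 e_0_6 e_0_1 e_1_2 e_0_11 e_7_11.symm (tri e_3_4.symm e_2_3.symm) n_4_7 (tri e_3_6.symm e_2_3.symm) n_6_7 n_1_7 (sy n_2_11) n_2_7
  have n_6_11 : ¬ G.Adj v6 v11 := by
    intro e_6_11
    exact nf (ne1 e_0_1.symm n_1_8) e_0_5.symm e_5_8 e_2_5.symm e_2_3 e_5_7 e_7_11 (tri e_0_4 e_3_4.symm) n_0_11 (sy n_3_8) (tri e_6_8.symm e_6_11) n_2_11 (sy n_3_7) (tri e_3_6 e_6_11)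
  have n_1_11 : ¬ G.Adj v1 v11 := by
    intro e_1_11
    have n_3_11 : ¬ G.Adj v3 v11 := by
      intro e_3_11
      exact nf (ne1 e_2_5 (tri e_2_3 e_3_6)) e_0_5 e_0_6 e_0_1 e_1_11 e_0_4 e_4_9 (tri e_5_7 e_7_11) (tri e_2_5.symm e_2_9) n_6_11 n_6_9 n_1_9 (tri e_3_4.symm e_3_11) (tri e_7_11.symm e_7_9)
    exact nf (ne1 e_0_4.symm n_4_10) e_0_1.symm e_1_10 e_1_2 e_2_3 e_1_11 e_7_11.symm (tri e_0_4 e_3_4.symm) (tri e_0_5 e_5_7) (sy n_3_10) (sy n_7_10) n_2_7 (sy n_3_11) n_3_7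
  have n_3_11 : ¬ G.Adj v3 v11 := by
    intro e_3_11
    exact nf (ne1 e_6_8.symm (sy n_4_8)).symm e_3_4 e_3_6 e_2_3.symm e_1_2.symm e_3_11 e_7_11.symm (tri e_0_4.symm e_0_1) n_4_7 (tri e_0_6.symm e_0_1) n_6_7 n_2_7 (sy n_1_11) n_1_7
  have e_8_11 : G.Adj v8 v11 := by
    by_contra n_8_11
    exact nf (ne1 e_0_1.symm n_1_8) e_0_5.symm e_5_8 e_2_5.symm e_2_3 e_5_7 e_7_11 (tri e_0_4 e_3_4.symm) n_0_11 (sy n_3_8) n_8_11 n_2_11 (sy n_3_7) n_3_11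
  have n_4_11 : ¬ G.Adj v4 v11 := by
    intro e_4_11
    exact nf (ne1 e_3_6.symm n_6_9) e_3_4.symm e_4_9 e_0_4.symm e_0_1 e_4_11 e_8_11.symm (tri e_2_3.symm e_1_2.symm) n_3_8 (sy n_1_9) (sy n_8_9) (tri e_0_5 e_5_8) (sy n_1_11) n_1_8
  have e_10_11 : G.Adj v10 v11 := by
    by_contra n_10_11
    exact nf (ne1 e_0_4.symm n_4_10) e_0_6.symm e_6_10 e_3_6.symm e_2_3.symm e_6_8 e_8_11 (tri e_0_1 e_1_2) n_0_11 (tri e_1_10.symm e_1_2) n_10_11 n_3_11 (sy n_2_8) n_2_11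
  have typ : ∀ v12 : V, v12 ≠ v0 → v12 ≠ v1 → v12 ≠ v2 → v12 ≠ v3 → v12 ≠ v4 → v12 ≠ v5 → v12 ≠ v6 → v12 ≠ v7 → v12 ≠ v8 → v12 ≠ v9 → v12 ≠ v10 → v12 ≠ v11 →
      (¬ G.Adj v3 v12 ∧ ¬ G.Adj v4 v12 ∧ G.Adj v0 v12 ∧ G.Adj v2 v12 ∧ G.Adj v7 v12 ∧
        G.Adj v8 v12 ∧ G.Adj v10 v12) ∨
      (¬ G.Adj v3 v12 ∧ ¬ G.Adj v4 v12 ∧ G.Adj v1 v12 ∧ G.Adj v5 v12 ∧ G.Adj v11 v12) ∨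
      (¬ G.Adj v0 v12 ∧ ¬ G.Adj v1 v12 ∧ ¬ G.Adj v2 v12 ∧ ¬ G.Adj v3 v12 ∧ ¬ G.Adj v4 v12 ∧ ¬ G.Adj v5 v12 ∧ ¬ G.Adj v6 v12 ∧ ¬ G.Adj v7 v12 ∧ ¬ G.Adj v8 v12 ∧ ¬ G.Adj v9 v12 ∧ ¬ G.Adj v10 v12 ∧ ¬ G.Adj v11 v12) := by
    intro v12 d_12_0 d_12_1 d_12_2 d_12_3 d_12_4 d_12_5 d_12_6 d_12_7 d_12_8 d_12_9 d_12_10 d_12_11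
    have n_3_12 : ¬ G.Adj v3 v12 := by
      intro e_3_12
      have n_1_12 : ¬ G.Adj v1 v12 := by
        intro e_1_12
        have n_11_12 : ¬ G.Adj v11 v12 := by
          intro e_11_12
          have n_9_12 : ¬ G.Adj v9 v12 := by
            intro e_9_12
            exact nf (ne1 e_3_6.symm n_6_9) e_3_12.symm e_9_12.symm e_1_12.symm e_0_1.symm e_11_12.symm e_8_11.symm (tri e_3_4 e_0_4.symm) n_3_8 (sy n_0_9) (sy n_8_9) n_1_8 (sy n_0_11) (tri e_0_5 e_5_8)
          exact nf (ne1 e_0_1.symm n_1_8) e_0_6.symm e_6_8 e_3_6.symm e_3_12 e_6_10 e_9_10.symm (tri e_0_1 e_1_12) n_0_9 (tri e_8_11 e_11_12) n_8_9 n_3_9 (tri e_1_10.symm e_1_12) (sy n_9_12)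
        exact nf d_12_2.symm e_1_2 e_1_12 e_0_1.symm e_0_4 e_1_10 e_10_11 (tri e_2_3 e_3_4) n_2_11 (tri e_3_12.symm e_3_4) (sy n_11_12) n_0_11 (sy n_4_10) n_4_11
      have n_10_12 : ¬ G.Adj v10 v12 := by
        intro e_10_12
        have n_7_12 : ¬ G.Adj v7 v12 := by
          intro e_7_12
          exact nf (ne1 e_6_8.symm (sy n_4_8)).symm e_3_4 e_3_6 e_2_3.symm e_1_2.symm e_3_12 e_7_12.symm (tri e_0_4.symm e_0_1) n_4_7 (tri e_0_6.symm e_0_1) n_6_7 n_2_7 (sy n_1_12) n_1_7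
        exact nf d_12_6.symm e_6_10.symm e_10_12 e_1_10.symm e_1_2 e_10_11 e_7_11.symm (tri e_3_6.symm e_2_3.symm) n_6_7 (tri e_3_12.symm e_2_3.symm) (sy n_7_12) n_1_7 (sy n_2_11) n_2_7
      have n_5_12 : ¬ G.Adj v5 v12 := by
        intro e_5_12
        exact nf d_12_4.symm e_3_4 e_3_12 e_2_3.symm e_1_2.symm e_3_6 e_6_8 (tri e_0_4.symm e_0_1) n_4_8 (sy n_1_12) (tri e_5_12.symm e_5_8) n_2_8 (tri e_0_6.symm e_0_1) n_1_8
      exact nf d_12_4.symm e_3_4 e_3_12 e_2_3.symm e_2_5 e_3_6 e_6_10 (tri e_0_4.symm e_0_5) n_4_10 (sy n_5_12) (sy n_10_12) (tri e_1_2.symm e_1_10) (tri e_0_6.symm e_0_5) n_5_10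
    have n_4_12 : ¬ G.Adj v4 v12 := by
      intro e_4_12
      have n_1_12 : ¬ G.Adj v1 v12 := by
        intro e_1_12
        have n_11_12 : ¬ G.Adj v11 v12 := by
          intro e_11_12
          have n_6_12 : ¬ G.Adj v6 v12 := by
            intro e_6_12
            exact nf (ne1 e_6_8.symm (sy n_4_8)).symm e_4_12.symm e_6_12.symm e_1_12.symm e_1_2 e_11_12.symm e_7_11.symm (tri e_3_4.symm e_2_3.symm) n_4_7 (tri e_3_6.symm e_2_3.symm) n_6_7 n_1_7 (sy n_2_11) n_2_7
          exact nf (ne1 e_1_2 n_1_7) e_2_9.symm e_7_9.symm e_4_9.symm e_4_12 e_9_10 e_6_10.symm (tri e_1_2.symm e_1_12) (tri e_2_3 e_3_6) (tri e_7_11 e_11_12) (sy n_6_7) (tri e_0_4.symm e_0_6) (tri e_1_10.symm e_1_12) (sy n_6_12)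
        exact nf d_12_0.symm e_0_1.symm e_1_12 e_1_2 e_2_3 e_1_10 e_10_11 (tri e_0_4 e_3_4.symm) n_0_11 (sy n_3_12) (sy n_11_12) n_2_11 (sy n_3_10) n_3_11
      have n_10_12 : ¬ G.Adj v10 v12 := by
        intro e_10_12
        have n_8_12 : ¬ G.Adj v8 v12 := by
          intro e_8_12
          exact nf (ne1 e_3_6.symm n_6_9) e_3_4.symm e_4_9 e_0_4.symm e_0_1 e_4_12 e_8_12.symm (tri e_2_3.symm e_1_2.symm) n_3_8 (sy n_1_9) (sy n_8_9) (tri e_0_5 e_5_8) (sy n_1_12) n_1_8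
        exact nf d_12_9.symm e_9_10.symm e_10_12 e_1_10.symm e_0_1.symm e_10_11 e_8_11.symm (sy n_0_9) (sy n_8_9) (tri e_4_12.symm e_0_4.symm) (sy n_8_12) n_1_8 (sy n_0_11) (tri e_0_5 e_5_8)
      have n_5_12 : ¬ G.Adj v5 v12 := by
        intro e_5_12
        exact nf d_12_3.symm e_3_4.symm e_4_12 e_0_4.symm e_0_1 e_4_9 e_7_9.symm (tri e_2_3.symm e_1_2.symm) n_3_7 (sy n_1_12) (tri e_5_12.symm e_5_7) (tri e_0_5 e_5_7) (sy n_1_9) n_1_7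
      exact nf d_12_3.symm e_3_4.symm e_4_12 e_0_4.symm e_0_5 e_4_9 e_9_10 (tri e_2_3.symm e_2_5) n_3_10 (sy n_5_12) (sy n_10_12) (tri e_0_1 e_1_10) (tri e_2_9.symm e_2_5) n_5_10
    by_cases e_0_12 : G.Adj v0 v12
    · left
      have e_7_12 : G.Adj v7 v12 := by
        by_contra n_7_12
        exact nf d_12_1.symm e_0_1 e_0_12 e_0_4 e_3_4.symm e_0_5 e_5_7 (tri e_1_2 e_2_3) n_1_7 (sy n_3_12) (sy n_7_12) n_4_7 (tri e_2_5.symm e_2_3) n_3_7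
      have e_2_12 : G.Adj v2 v12 := by
        by_contra n_2_12
        exact nf (ne1 e_6_8.symm (sy n_4_8)).symm e_0_4 e_0_6 e_0_1 e_1_2 e_0_12 e_7_12.symm (tri e_3_4.symm e_2_3.symm) n_4_7 (tri e_3_6.symm e_2_3.symm) n_6_7 n_1_7 (sy n_2_12) n_2_7
      have e_8_12 : G.Adj v8 v12 := by
        by_contra n_8_12
        exact nf d_12_1.symm e_0_1 e_0_12 e_0_4 e_3_4.symm e_0_5 e_5_8 (tri e_1_2 e_2_3) n_1_8 (sy n_3_12) (sy n_8_12) n_4_8 (tri e_2_5.symm e_2_3) n_3_8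
      have e_10_12 : G.Adj v10 v12 := by
        by_contra n_10_12
        exact nf d_12_5.symm e_0_5 e_0_12 e_0_1 e_1_10 e_0_4 e_3_4.symm n_5_10 (tri e_2_5.symm e_2_3) (sy n_10_12) (sy n_3_12) (tri e_1_2 e_2_3) n_4_10 (sy n_3_10)
      exact ⟨n_3_12, n_4_12, e_0_12, e_2_12, e_7_12, e_8_12, e_10_12⟩
    have n_0_12 := e_0_12
    by_cases e_1_12 : G.Adj v1 v12
    · right; left
      have e_11_12 : G.Adj v11 v12 := by
        by_contra n_11_12
        exact nf d_12_2.symm e_1_2 e_1_12 e_0_1.symm e_0_4 e_1_10 e_10_11 (tri e_2_3 e_3_4) n_2_11 (sy n_4_12) (sy n_11_12) n_0_11 (sy n_4_10) n_4_11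
      have e_5_12 : G.Adj v5 v12 := by
        by_contra n_5_12
        have n_6_12 : ¬ G.Adj v6 v12 := by
          intro e_6_12
          exact nf d_12_10.symm e_6_10 e_6_12 e_3_6.symm e_3_4 e_6_8 e_5_8.symm (sy n_4_10) (sy n_5_10) (sy n_4_12) (sy n_5_12) (tri e_2_3.symm e_2_5) (sy n_4_8) (tri e_0_4.symm e_0_5)
        exact nf (ne1 e_6_8.symm (sy n_4_8)).symm e_0_4 e_0_6 e_0_1 e_1_12 e_0_5 e_5_7 n_4_12 n_4_7 n_6_12 n_6_7 n_1_7 n_5_12 (tri e_11_12.symm e_7_11.symm)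
      exact ⟨n_3_12, n_4_12, e_1_12, e_5_12, e_11_12⟩
    have n_1_12 := e_1_12
    have n_6_12 : ¬ G.Adj v6 v12 := by
      intro e_6_12
      exact nf d_12_8.symm e_6_8 e_6_12 e_3_6.symm e_3_4 e_6_10 e_1_10.symm (sy n_4_8) (sy n_1_8) (sy n_4_12) (sy n_1_12) (tri e_2_3.symm e_1_2.symm) (sy n_4_10) (tri e_0_4.symm e_0_1)
    have n_5_12 : ¬ G.Adj v5 v12 := by
      intro e_5_12
      exact nf d_12_7.symm e_5_7 e_5_12 e_2_5.symm e_1_2.symm e_5_8 e_6_8.symm (sy n_1_7) (sy n_6_7) (sy n_1_12) (sy n_6_12) (tri e_2_3 e_3_6) (sy n_1_8) (tri e_0_1.symm e_0_6)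
    have n_9_12 : ¬ G.Adj v9 v12 := by
      intro e_9_12
      exact nf (ne1 e_5_7.symm (sy n_1_7)).symm e_1_2.symm e_2_5 e_2_3 e_3_6 e_2_9 e_9_12 (tri e_0_1.symm e_0_6) n_1_12 (tri e_0_5.symm e_0_6) n_5_12 n_3_12 (sy n_6_9) n_6_12
    have n_11_12 : ¬ G.Adj v11 v12 := by
      intro e_11_12
      exact nf (ne1 e_0_1 n_0_9) e_1_10.symm e_9_10.symm e_6_10.symm e_3_6.symm e_10_11 e_11_12 (tri e_1_2 e_2_3) n_1_12 (sy n_3_9) n_9_12 n_6_12 (sy n_3_11) n_3_12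
    have n_2_12 : ¬ G.Adj v2 v12 := by
      intro e_2_12
      have n_8_12 : ¬ G.Adj v8 v12 := by
        intro e_8_12
        exact nf (ne1 e_3_6.symm n_6_9) e_2_3 e_2_9 e_1_2.symm e_0_1.symm e_2_12 e_8_12.symm (tri e_3_4 e_0_4.symm) n_3_8 (sy n_0_9) (sy n_8_9) n_1_8 (sy n_0_12) (tri e_0_5 e_5_8)
      exact nf d_12_1.symm e_1_2.symm e_2_12 e_2_3 e_3_4 e_2_5 e_5_8 (tri e_0_1.symm e_0_4) n_1_8 (sy n_4_12) (sy n_8_12) n_3_8 (tri e_0_5.symm e_0_4) n_4_8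
    have n_10_12 : ¬ G.Adj v10 v12 := by
      intro e_10_12
      exact nf d_12_11.symm e_10_11 e_10_12 e_6_10.symm e_0_6.symm e_9_10.symm e_2_9.symm (sy n_0_11) (sy n_2_11) (sy n_0_12) (sy n_2_12) (tri e_3_6.symm e_2_3.symm) (sy n_0_9) (tri e_0_1 e_1_2)
    have n_7_12 : ¬ G.Adj v7 v12 := by
      intro e_7_12
      exact nf (ne1 e_2_3.symm n_3_10) e_2_9.symm e_9_10 e_4_9.symm e_0_4.symm e_7_9.symm e_7_12 (tri e_1_2.symm e_0_1.symm) n_2_12 (tri e_1_10.symm e_0_1.symm) n_10_12 n_4_12 (tri e_5_7.symm e_0_5.symm) n_0_12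
    have n_8_12 : ¬ G.Adj v8 v12 := by
      intro e_8_12
      exact nf (ne1 e_1_2 n_1_7) e_2_5.symm e_5_7 e_0_5.symm e_0_4 e_5_8 e_8_12 (tri e_2_3 e_3_4) n_2_12 (sy n_4_7) n_7_12 n_0_12 (sy n_4_8) n_4_12
    right; right
    exact ⟨n_0_12, n_1_12, n_2_12, n_3_12, n_4_12, n_5_12, n_6_12, n_7_12, n_8_12, n_9_12, n_10_12, n_11_12⟩
  let P : Set V := {v0, v1, v2, v3, v4, v5, v6, v7, v8, v9, v10, v11}
  let A : Set V := {z | ∃ x ∈ P, G.Adj x z}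
  have key : ∀ v12 ∈ A, v12 ∈ P ∨
      (¬ G.Adj v3 v12 ∧ ¬ G.Adj v4 v12 ∧ G.Adj v0 v12 ∧ G.Adj v2 v12 ∧ G.Adj v7 v12 ∧
        G.Adj v8 v12 ∧ G.Adj v10 v12) ∨
      (¬ G.Adj v3 v12 ∧ ¬ G.Adj v4 v12 ∧ G.Adj v1 v12 ∧ G.Adj v5 v12 ∧ G.Adj v11 v12) := by
    intro z hz
    by_cases hP : z ∈ P
    · exact Or.inl hP
    right
    have hP' := hP
    simp only [P, Set.mem_insert_iff, Set.mem_singleton_iff, not_or] at hP'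
    obtain ⟨d0, d1, d2, d3, d4, d5, d6, d7, d8, d9, d10, d11⟩ := hP'
    rcases typ z d0 d1 d2 d3 d4 d5 d6 d7 d8 d9 d10 d11 with h | h | h
    · exact Or.inl h
    · exact Or.inr h
    · exfalso
      obtain ⟨x, hx, hxz⟩ := hz
      obtain ⟨m0, m1, m2, m3, m4, m5, m6, m7, m8, m9, m10, m11⟩ := h
      rcases hx with rfl | rfl | rfl | rfl | rfl | rfl | rfl | rfl | rfl | rfl | rfl | rfl <;> contradiction
  have closed : ∀ y ∈ A, ∀ z, G.Adj y z → z ∈ A := by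
    intro v12 hy v13 e_12_13
    by_contra hz
    have hz' : ∀ x ∈ P, ¬ G.Adj x v13 := fun x hx h => hz ⟨x, hx, h⟩
    rcases key v12 hy with h | h | h
    · exact hz' _ h e_12_13
    all_goals
      have n_0_13 := hz' v0 (by simp [P])
      have n_1_13 := hz' v1 (by simp [P])
      have n_2_13 := hz' v2 (by simp [P])
      have n_3_13 := hz' v3 (by simp [P])
      have n_4_13 := hz' v4 (by simp [P])
      have n_5_13 := hz' v5 (by simp [P])
      have n_6_13 := hz' v6 (by simp [P])
      have n_7_13 := hz' v7 (by simp [P])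
      have n_8_13 := hz' v8 (by simp [P])
      have n_9_13 := hz' v9 (by simp [P])
      have n_10_13 := hz' v10 (by simp [P])
      have n_11_13 := hz' v11 (by simp [P])
    · obtain ⟨n_3_12, n_4_12, e_0_12, e_2_12, e_7_12, e_8_12, e_10_12⟩ := h
      exact nf (ne1 e_5_7.symm (sy n_1_7)).symm e_0_1 e_0_5 e_0_4 e_3_4.symm e_0_12 e_12_13 (tri e_1_2 e_2_3) n_1_13 (tri e_2_5.symm e_2_3) n_5_13 n_4_13 (sy n_3_12) n_3_13
    · obtain ⟨n_3_12, n_4_12, e_1_12, e_5_12, e_11_12⟩ := h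
      exact nf (ne1 e_2_3.symm n_3_10) e_1_2 e_1_10 e_0_1.symm e_0_4 e_1_12 e_12_13 (tri e_2_3 e_3_4) n_2_13 (sy n_4_10) n_10_13 n_0_13 (sy n_4_12) n_4_13
  have c510 : ∀ z ∈ A, G.Adj v5 z → ¬ G.Adj v10 z := by
    intro z hz h5 h10
    rcases key z hz with h | h | h
    · rcases h with rfl | rfl | rfl | rfl | rfl | rfl | rfl | rfl | rfl | rfl | rfl | rfl
      · exact (tri e_1_10.symm e_0_1.symm) h10
      · exact (tri e_0_5.symm e_0_1) h5
      · exact (tri e_1_10.symm e_1_2) h10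
      · exact (tri e_2_5.symm e_2_3) h5
      · exact (tri e_0_5.symm e_0_4) h5
      · exact absurd h5 G.irrefl
      · exact (tri e_0_5.symm e_0_6) h5
      · exact (sy n_7_10) h10
      · exact (tri e_6_10.symm e_6_8) h10
      · exact (tri e_2_5.symm e_2_9) h5
      · exact absurd h10 G.irrefl
      · exact (tri e_5_7 e_7_11) h5
    · exact tri e_0_5 h5 h.2.2.1
    · exact tri e_1_10 h10 h.2.2.1
  have c3 : ∀ z ∈ A, G.Adj v3 z → z = v2 ∨ z = v4 ∨ z = v6 := by
    intro z hz h3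
    rcases key z hz with h | h | h
    · rcases h with rfl | rfl | rfl | rfl | rfl | rfl | rfl | rfl | rfl | rfl | rfl | rfl
      · exact absurd h3 (tri e_3_4 e_0_4.symm)
      · exact absurd h3 (tri e_2_3.symm e_1_2.symm)
      · exact Or.inl rfl
      · exact absurd h3 G.irrefl
      · exact Or.inr (Or.inl rfl)
      · exact absurd h3 (tri e_2_3.symm e_2_5)
      · exact Or.inr (Or.inr rfl)
      · exact absurd h3 n_3_7
      · exact absurd h3 n_3_8
      · exact absurd h3 n_3_9
      · exact absurd h3 n_3_10
      · exact absurd h3 n_3_11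
    · exact absurd h3 h.1
    · exact absurd h3 h.1
  have cover : ∀ z ∈ A, z = v2 ∨ z = v3 ∨ z = v4 ∨ G.Adj v5 z ∨ z = v10 ∨ G.Adj v10 z ∨ z = v5 := by
    intro z hz
    rcases key z hz with h | h | h
    · rcases h with rfl | rfl | rfl | rfl | rfl | rfl | rfl | rfl | rfl | rfl | rfl | rfl
      · exact Or.inr (Or.inr (Or.inr (Or.inl (e_0_5.symm))))
      · exact Or.inr (Or.inr (Or.inr (Or.inr (Or.inr (Or.inl (e_1_10.symm))))))
      · exact Or.inl (rfl)
      · exact Or.inr (Or.inl (rfl))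
      · exact Or.inr (Or.inr (Or.inl (rfl)))
      · exact Or.inr (Or.inr (Or.inr (Or.inr (Or.inr (Or.inr (rfl))))))
      · exact Or.inr (Or.inr (Or.inr (Or.inr (Or.inr (Or.inl (e_6_10.symm))))))
      · exact Or.inr (Or.inr (Or.inr (Or.inl (e_5_7))))
      · exact Or.inr (Or.inr (Or.inr (Or.inl (e_5_8))))
      · exact Or.inr (Or.inr (Or.inr (Or.inr (Or.inr (Or.inl (e_9_10.symm))))))
      · exact Or.inr (Or.inr (Or.inr (Or.inr (Or.inl (rfl)))))
      · exact Or.inr (Or.inr (Or.inr (Or.inr (Or.inr (Or.inl (e_10_11))))))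
    · exact Or.inr (Or.inr (Or.inr (Or.inr (Or.inr (Or.inl h.2.2.2.2.2.2)))))
    · exact Or.inr (Or.inr (Or.inr (Or.inl h.2.2.2.1)))
  have hv0 : v0 ∈ A := ⟨v1, by simp [P], e_0_1.symm⟩
  obtain ⟨f⟩ := induce_col hG Aᶜ v0 (by simpa using hv0)
  have hf : ∀ a b (ha : a ∉ A) (hb : b ∉ A), G.Adj a b → f ⟨a, ha⟩ ≠ f ⟨b, hb⟩ :=
    fun a b ha hb h => f.valid (by simpa using h)
  let col : V → Fin 3 := fun z => if z = v2 ∨ z = v4 then 2 else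
    if G.Adj v5 z ∨ z = v10 ∨ z = v3 then 0 else 1
  have hcol : ∀ a b, a ∈ A → b ∈ A → G.Adj a b → col a ≠ col b := by
    intro a b ha hb hab
    exact col_valid (tri e_2_3 e_3_4) (tri e_2_3.symm e_2_5) (tri e_0_5.symm e_0_6)
      n_3_10 n_5_10 (c510 a ha) (c510 b hb) (c3 a ha) (c3 b hb) (cover a ha) (cover b hb)
      (fun h => tri h hab) (fun h => tri h hab) hab
  apply not_col hG
  refine ⟨Coloring.mk (fun z => if h : z ∈ A then col z else f ⟨z, h⟩) ?_⟩
  intro a b hab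
  by_cases ha : a ∈ A <;> by_cases hb : b ∈ A
  · simpa [ha, hb] using hcol a b ha hb hab
  · exact absurd (closed a ha b hab) hb
  · exact absurd (closed b hb a hab.symm) ha
  · simpa [ha, hb] using hf a b ha hb hab

theorem core_sym {V : Type} [Fintype V] {G : SimpleGraph V} (hG : MinCex G)
    {v0 v1 v2 v3 v4 v5 v6 v7 v8 : V}
    (e_0_1 : G.Adj v0 v1) (e_1_2 : G.Adj v1 v2) (e_2_3 : G.Adj v2 v3) (e_3_4 : G.Adj v3 v4) (e_0_4 : G.Adj v0 v4)
    (e_0_5 : G.Adj v0 v5) (e_0_6 : G.Adj v0 v6) (e_5_7 : G.Adj v5 v7) (e_5_8 : G.Adj v5 v8) (e_6_8 : G.Adj v6 v8)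
    (n_7_8 : ¬ G.Adj v7 v8) (n_6_7 : ¬ G.Adj v6 v7) (n_1_7 : ¬ G.Adj v1 v7) (n_2_7 : ¬ G.Adj v2 v7) (n_3_7 : ¬ G.Adj v3 v7) (n_4_7 : ¬ G.Adj v4 v7)
    (n_1_8 : ¬ G.Adj v1 v8) (n_2_8 : ¬ G.Adj v2 v8) (n_3_8 : ¬ G.Adj v3 v8) (n_4_8 : ¬ G.Adj v4 v8) :
    False := by
  have tri : ∀ {x y z : V}, G.Adj x y → G.Adj y z → ¬ G.Adj x z := fun h h' => tri_free hG.1 h h'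
  have nf := @no_fork V G hG.1 hG.2.1
  have sy : ∀ {x y : V}, ¬ G.Adj x y → ¬ G.Adj y x := fun h h' => h h'.symm
  have ne1 : ∀ {w x y : V}, G.Adj w x → ¬ G.Adj w y → x ≠ y := fun h h' e => h' (e ▸ h)
  by_cases e_3_6 : G.Adj v3 v6
  · by_cases e_2_5 : G.Adj v2 v5
    · exact core hG e_0_1 e_1_2 e_2_3 e_3_4 e_0_4 e_0_5 e_0_6 e_5_7 e_5_8 e_6_8 n_7_8 n_6_7
        n_1_7 n_2_7 n_3_7 n_4_7 n_1_8 n_2_8 n_3_8 n_4_8 e_2_5 e_3_6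
    · have n_2_5 := e_2_5
      have n_2_6 := tri e_2_3 e_3_6
      exact nf (ne1 e_6_8.symm (sy n_4_8)).symm e_0_4 e_0_6 e_0_1 e_1_2 e_0_5 e_5_7 (tri e_3_4.symm e_2_3.symm) n_4_7 (sy n_2_6) n_6_7 n_1_7 (sy n_2_5) n_2_7
  · have n_3_6 := e_3_6
    by_cases e_3_5 : G.Adj v3 v5
    · by_cases e_2_6 : G.Adj v2 v6
      · exact core hG e_0_4 e_3_4.symm e_2_3.symm e_1_2.symm e_0_1 e_0_5 e_0_6 e_5_7 e_5_8 e_6_8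
          n_7_8 n_6_7 n_4_7 n_3_7 n_2_7 n_1_7 n_4_8 n_3_8 n_2_8 n_1_8 e_3_5 e_2_6
      · have n_2_6 := e_2_6
        have n_2_5 := tri e_2_3 e_3_5
        exact nf (ne1 e_6_8.symm (sy n_4_8)).symm e_0_4 e_0_6 e_0_1 e_1_2 e_0_5 e_5_7 (tri e_3_4.symm e_2_3.symm) n_4_7 (sy n_2_6) n_6_7 n_1_7 (sy n_2_5) n_2_7
    · have n_3_5 := e_3_5
      exact nf (ne1 e_6_8.symm (sy n_1_8)).symm e_0_1 e_0_6 e_0_4 e_3_4.symm e_0_5 e_5_7 (tri e_1_2 e_2_3) n_1_7 (sy n_3_6) n_6_7 n_4_7 (sy n_3_5) n_3_7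

theorem far {V : Type} {G : SimpleGraph V} {c : Fin 5 → V} {u : V} (h : distC G c u = 2)
    (i : Fin 5) : ¬ G.Adj (c i) u := by
  intro hi
  have h1 : distC G c u ≤ G.dist u (c i) := Finset.inf'_le _ (Finset.mem_univ i)
  rw [h, dist_eq_one_iff_adj.2 hi.symm] at h1
  omega

theorem minCex_independent_paths_complete {V : Type} [Fintype V]
    (G : SimpleGraph V) (hG : MinCex G) (c : Fin 5 → V) (hc : IsC5 G c)
    (u1 u2 : V) (hne : u1 ≠ u2) (hnadj : ¬ G.Adj u1 u2)
    (h1 : distC G c u1 = 2) (h2 : distC G c u2 = 2)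
    (k : Fin 5) (a1 b1 : V)
    (ha1 : G.Adj u1 a1) (ha1v : G.Adj a1 (c k))
    (hb1 : G.Adj u2 b1) (hb1v : G.Adj b1 (c k))
    (hab : a1 ≠ b1) (ha1c : a1 ∉ Set.range c) (hb1c : b1 ∉ Set.range c) :
    G.Adj a1 u2 ∧ G.Adj b1 u1 := by
  have tri : ∀ {x y z : V}, G.Adj x y → G.Adj y z → ¬ G.Adj x z := fun h h' => tri_free hG.1 h h'
  have sy : ∀ {x y : V}, ¬ G.Adj x y → ¬ G.Adj y x := fun h h' => h h'.symm
  have f1 := far h1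
  have f2 := far h2
  have e01 := hc.2 k
  have e12 := hc.2 (k + 1)
  have e23 := hc.2 (k + 1 + 1)
  have e34 := hc.2 (k + 1 + 1 + 1)
  have e40 := hc.2 (k + 1 + 1 + 1 + 1)
  have h5 : k + 1 + 1 + 1 + 1 + 1 = k :=
    (by decide : ∀ j : Fin 5, j + 1 + 1 + 1 + 1 + 1 = j) k
  rw [h5] at e40
  by_cases A : G.Adj a1 u2 <;> by_cases B : G.Adj b1 u1
  · exact ⟨A, B⟩
  · exact (core_sym hG e01 e12 e23 e34 e40.symm ha1v.symm hb1v.symm ha1.symm A hb1.symm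
      hnadj B (f1 _) (f1 _) (f1 _) (f1 _) (f2 _) (f2 _) (f2 _) (f2 _)).elim
  · exact (core_sym hG e01 e12 e23 e34 e40.symm hb1v.symm ha1v.symm hb1.symm B ha1.symm
      (sy hnadj) A (f2 _) (f2 _) (f2 _) (f2 _) (f1 _) (f1 _) (f1 _) (f1 _)).elim
  · have hd : c (k + 1) ≠ c (k + 1 + 1 + 1 + 1) := fun e => tri e12 e23 (e ▸ e34.symm)
    exact (no_fork hG.1 hG.2.1 hd e01 e40.symm ha1v.symm ha1.symm hb1v.symm hb1.symm
      (f1 _) (f2 _) (f1 _) (f2 _) A B hnadj).elim
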